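/- There is a function B from dimension sequences δ = (δ_1,…,δ_d) ∈ ℕ^d to the positive integers, independent of N and of K, such that for every algebraically closed field K and every finite-dimensional graded K-vector subspace V = V_1 ⊕ … ⊕ V_d of R = K[x_1,…,x_N] with dimension sequence δ, there exist an integer s ≤ B(δ) and forms G_1,…,G_s in R of positive degree at most d which form a regular sequence in R and such that V is contained in the K-subalgebra K[G_1,…,G_s] of R. -/

import Mathlib

open MvPolynomial

/-- The height of an ideal: the infimum of the heights of the prime ideals containing it
(so the unit ideal has height `⊤`). -/
noncomputable def idealHeight {R : Type*} [CommRing R] (I : Ideal R) : ℕ∞ :=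
  ⨅ (P : PrimeSpectrum R) (_ : I ≤ P.asIdeal), Order.height P

/-- A Noetherian local ring is regular if its maximal ideal is generated by
(Krull dimension)-many elements. -/
def IsRegularLocal (A : Type*) [CommRing A] [IsLocalRing A] : Prop :=
  IsNoetherianRing A ∧
    ∃ s : Finset A, Ideal.span (s : Set A) = IsLocalRing.maximalIdeal A ∧
      (s.card : WithBot ℕ∞) = ringKrullDim A

/-- Serre's condition `R_η` for a ring `A`: for every prime ideal `P` of `A` of height
at most `η`, the localization of `A` at `P` is a regular local ring. -/
def SerreConditionR (η : ℕ) (A : Type*) [CommRing A] : Prop :=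
  ∀ (P : Ideal A) [hP : P.IsPrime],
    Order.height (⟨P, hP⟩ : PrimeSpectrum A) ≤ (η : ℕ∞) →
      IsRegularLocal (Localization.AtPrime P)

/-- `G` is an `R_η`-sequence: it generates a proper ideal and the quotient of the ring by the
ideal generated by each initial segment satisfies Serre's condition `R_η`. -/
def IsRnSequence (η : ℕ) {R : Type*} [CommRing R] {s : ℕ} (G : Fin s → R) : Prop :=
  Ideal.span (Set.range G) ≠ ⊤ ∧
    ∀ i : ℕ, i ≤ s →
      SerreConditionR η (R ⧸ Ideal.span (G '' {j : Fin s | (j : ℕ) < i}))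

/-- `F`, a form of degree `d`, has a `k`-collapse: `F` lies in an ideal generated by
`k` forms of strictly smaller positive degree.  A form of degree `d` has strength at
least `s` iff it has no `s`-collapse. -/
def HasCollapse {K : Type*} [CommSemiring K] {σ : Type*} (d k : ℕ)
    (F : MvPolynomial σ K) : Prop :=
  ∃ (G : Fin k → MvPolynomial σ K) (e : Fin k → ℕ),
    (∀ i, 0 < e i ∧ e i < d ∧ (G i).IsHomogeneous (e i)) ∧
    F ∈ Ideal.span (Set.range G)

universe u

section Depth

variable {R : Type*} [CommRing R]

/-- `x` is a nonzerodivisor modulo the ideal `I`. -/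
def IsRegularMod (I : Ideal R) (x : R) : Prop := ∀ y, x * y ∈ I → y ∈ I

/-- `R ⧸ I` has a maximal regular sequence of length `k` inside the ideal `n`, and `n`
annihilates a nonzero element of the quotient by that sequence. -/
def HasDepth (n : Ideal R) : ℕ → Ideal R → Prop
  | 0, I => ∃ u, u ∉ I ∧ ∀ a ∈ n, a * u ∈ I
  | k + 1, I => ∃ x ∈ n, IsRegularMod I x ∧ HasDepth n k (I ⊔ Ideal.span {x})

lemma not_isRegularMod_of_hasDepth_zero {n I : Ideal R} (h : HasDepth n 0 I) {x : R}
    (hx : x ∈ n) : ¬ IsRegularMod I x := by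
  obtain ⟨u, hu, hn⟩ := h
  exact fun hr => hu (hr u (hn x hx))

lemma not_hasDepth_zero_of_succ {n I : Ideal R} {k : ℕ} (h : HasDepth n (k + 1) I) :
    ¬ HasDepth n 0 I := by
  obtain ⟨x, hx, hr, -⟩ := h
  exact fun h0 => not_isRegularMod_of_hasDepth_zero h0 hx hr

lemma mem_sup_span_singleton_iff {I : Ideal R} {x y : R} :
    y ∈ I ⊔ Ideal.span {x} ↔ ∃ a, y - x * a ∈ I := by
  rw [sup_comm, Ideal.mem_span_singleton_sup]
  constructor
  · rintro ⟨a, b, hb, rfl⟩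
    exact ⟨a, by convert hb using 1; ring⟩
  · rintro ⟨a, ha⟩
    exact ⟨a, _, ha, by ring⟩

lemma isSMulRegular_quotient_iff {I : Ideal R} {x : R} :
    IsSMulRegular (R ⧸ I) x ↔ IsRegularMod I x := by
  rw [isSMulRegular_iff_right_eq_zero_of_smul]
  constructor
  · intro h y hy
    rw [← Ideal.Quotient.eq_zero_iff_mem]
    apply h
    rw [Algebra.smul_def, Ideal.Quotient.algebraMap_eq, ← map_mul]
    exact Ideal.Quotient.eq_zero_iff_mem.2 hy
  · intro h m
    obtain ⟨y, rfl⟩ := Ideal.Quotient.mk_surjective m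
    rw [Algebra.smul_def, Ideal.Quotient.algebraMap_eq, ← map_mul,
      Ideal.Quotient.eq_zero_iff_mem, Ideal.Quotient.eq_zero_iff_mem]
    exact h y

lemma IsAssociatedPrime.exists_mem_iff_mul_mem [IsNoetherianRing R] {I P : Ideal R}
    (h : IsAssociatedPrime P (R ⧸ I)) : ∃ u, ∀ a, a ∈ P ↔ a * u ∈ I := by
  obtain ⟨-, m, rfl⟩ := isAssociatedPrime_iff.1 h
  obtain ⟨u, rfl⟩ := Ideal.Quotient.mk_surjective m
  refine ⟨u, fun a => ?_⟩
  rw [Submodule.mem_colon_singleton, Submodule.mem_bot, Algebra.smul_def,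
    Ideal.Quotient.algebraMap_eq, ← map_mul, Ideal.Quotient.eq_zero_iff_mem]

lemma exists_mem_isRegularMod [IsNoetherianRing R] {n : Ideal R}
    (S : Finset (Ideal R)) (hS : ∀ I ∈ S, ¬ HasDepth n 0 I) :
    ∃ z ∈ n, ∀ I ∈ S, IsRegularMod I z := by
  classical
  by_contra! hcon
  have hfin : (⋃ I ∈ S, associatedPrimes R (R ⧸ I)).Finite :=
    S.finite_toSet.biUnion fun I _ => associatedPrimes.finite R (R ⧸ I)
  have hsub : (n : Set R) ⊆ ⋃ P ∈ (⋃ I ∈ S, associatedPrimes R (R ⧸ I)), (P : Set R) := by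
    intro z hz
    obtain ⟨I, hI, hz'⟩ := hcon z hz
    have : z ∈ ⋃ P ∈ associatedPrimes R (R ⧸ I), (P : Set R) := by
      rw [biUnion_associatedPrimes_eq_compl_regular]
      exact fun h => hz' (isSMulRegular_quotient_iff.1 h)
    simp only [Set.mem_iUnion] at this ⊢
    obtain ⟨P, hP, hzP⟩ := this
    exact ⟨P, ⟨I, hI, hP⟩, hzP⟩
  rw [Ideal.subset_union_prime_finite hfin ⊤ ⊤ ?_] at hsub
  · obtain ⟨P, hP, hnP⟩ := hsub
    simp only [Set.mem_iUnion] at hP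
    obtain ⟨I, hI, hP⟩ := hP
    have hP' : IsAssociatedPrime P (R ⧸ I) := hP
    obtain ⟨u, hu⟩ := hP'.exists_mem_iff_mul_mem
    refine hS I hI ⟨u, fun h => hP'.isPrime.ne_top ?_, fun a ha => (hu a).1 (hnP ha)⟩
    rw [Ideal.eq_top_iff_one, hu, one_mul]
    exact h
  · intro P hP _ _
    simp only [Set.mem_iUnion] at hP
    obtain ⟨I, hI, hP⟩ := hP
    exact IsAssociatedPrime.isPrime hP

lemma IsRegularMod.swap {I : Ideal R} {x z : R} (hx : IsRegularMod I x)
    (hz : IsRegularMod (I ⊔ Ideal.span {x}) z) : IsRegularMod (I ⊔ Ideal.span {z}) x := by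
  intro y hy
  obtain ⟨a, ha⟩ := mem_sup_span_singleton_iff.1 hy
  have h1 : z * a ∈ I ⊔ Ideal.span {x} :=
    mem_sup_span_singleton_iff.2 ⟨y, by simpa using neg_mem ha⟩
  obtain ⟨b, hb⟩ := mem_sup_span_singleton_iff.1 (hz a h1)
  refine mem_sup_span_singleton_iff.2 ⟨b, hx _ ?_⟩
  have := I.add_mem ha (I.mul_mem_left z hb)
  convert this using 1
  ring

lemma HasDepth.zero_sup_span {n I : Ideal R} {x y : R} (hyn : y ∈ n)
    (hx : IsRegularMod I x) (hy : IsRegularMod I y)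
    (h : HasDepth n 0 (I ⊔ Ideal.span {x})) : HasDepth n 0 (I ⊔ Ideal.span {y}) := by
  obtain ⟨u, hu, hn⟩ := h
  obtain ⟨v, hv⟩ := mem_sup_span_singleton_iff.1 (hn y hyn)
  refine ⟨v, fun hmem => hu ?_, fun a ha => ?_⟩
  · obtain ⟨w, hw⟩ := mem_sup_span_singleton_iff.1 hmem
    refine mem_sup_span_singleton_iff.2 ⟨w, hy _ ?_⟩
    have := I.add_mem hv (I.mul_mem_left x hw)
    convert this using 1
    ring
  · obtain ⟨b, hb⟩ := mem_sup_span_singleton_iff.1 (hn a ha)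
    refine mem_sup_span_singleton_iff.2 ⟨b, hx _ ?_⟩
    have := I.sub_mem (I.mul_mem_left y hb) (I.mul_mem_left a hv)
    convert this using 1
    ring

/-- Cutting by any nonzerodivisor in `n` lowers the depth by exactly one. -/
lemma HasDepth.sup_span [IsNoetherianRing R] {n : Ideal R} {k : ℕ}
    {I : Ideal R} (h : HasDepth n (k + 1) I) {y : R} (hyn : y ∈ n) (hy : IsRegularMod I y) :
    HasDepth n k (I ⊔ Ideal.span {y}) := by
  classical
  induction k generalizing I y with
  | zero =>
    obtain ⟨x, hxn, hx, h0⟩ := h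
    exact h0.zero_sup_span hyn hx hy
  | succ k ih =>
    have hI := not_hasDepth_zero_of_succ h
    obtain ⟨x, hxn, hx, h1⟩ := h
    have hIx := not_hasDepth_zero_of_succ h1
    have hIy : ¬ HasDepth n 0 (I ⊔ Ideal.span {y}) := fun h0 =>
      hIx (h0.zero_sup_span hxn hy hx)
    obtain ⟨z, hzn, hz⟩ := exists_mem_isRegularMod (n := n)
      {I, I ⊔ Ideal.span {x}, I ⊔ Ideal.span {y}} (by
        intro J hJ
        simp only [Finset.mem_insert, Finset.mem_singleton] at hJ
        rcases hJ with rfl | rfl | rfl <;> assumption)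
    have hzI := hz I (by simp)
    have hzx := hz (I ⊔ Ideal.span {x}) (by simp)
    have hzy := hz (I ⊔ Ideal.span {y}) (by simp)
    have hIz : HasDepth n (k + 1) (I ⊔ Ideal.span {z}) := by
      refine ⟨x, hxn, hx.swap hzx, ?_⟩
      rw [sup_right_comm]
      exact ih h1 hzn hzx
    refine ⟨z, hzn, hzy, ?_⟩
    rw [sup_right_comm]
    exact ih hIz hyn (hy.swap hzy)

/-- `I` is generated by a weakly regular sequence of length `r`. -/
inductive IsGeneratedByRegular : ℕ → Ideal R → Prop
  | bot : IsGeneratedByRegular 0 ⊥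
  | sup_span {r : ℕ} {I : Ideal R} {x : R} : IsGeneratedByRegular r I → IsRegularMod I x →
      IsGeneratedByRegular (r + 1) (I ⊔ Ideal.span {x})

lemma isGeneratedByRegular_ofList {rs : List R}
    (h : RingTheory.Sequence.IsWeaklyRegular R rs) :
    IsGeneratedByRegular rs.length (Ideal.ofList rs) := by
  induction rs using List.reverseRecOn with
  | nil => simpa using IsGeneratedByRegular.bot
  | append_singleton rs x ih =>
    rw [RingTheory.Sequence.isWeaklyRegular_append_iff] at h
    obtain ⟨h1, h2⟩ := h
    rw [RingTheory.Sequence.isWeaklyRegular_singleton_iff, smul_eq_mul, Ideal.mul_top,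
      isSMulRegular_quotient_iff] at h2
    rw [Ideal.ofList_append, Ideal.ofList_singleton, List.length_append, List.length_singleton]
    exact (ih h1).sup_span h2

lemma IsGeneratedByRegular.exists_hasDepth [IsNoetherianRing R] {n : Ideal R} {N r : ℕ}
    {I : Ideal R} (h : IsGeneratedByRegular r I) (hN : HasDepth n N ⊥) (hI : I ≤ n) :
    ∃ k, r + k = N ∧ HasDepth n k I := by
  induction h with
  | bot => exact ⟨N, by simp, hN⟩
  | @sup_span r I x _ hx ih =>
    obtain ⟨k, hk, hd⟩ := ih (le_sup_left.trans hI)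
    have hxn : x ∈ n := hI (Ideal.mem_sup_right (Ideal.mem_span_singleton_self x))
    cases k with
    | zero => exact (not_isRegularMod_of_hasDepth_zero hd hxn hx).elim
    | succ k => exact ⟨k, by omega, hd.sup_span hxn hx⟩

end Depth

section PolynomialRing

variable {K : Type*} [Field K] {N : ℕ}

/-- The substitution fixing `X i` for `k ≤ i` and sending `X i` to the constant `a i` for
`i < k`. -/
noncomputable def partialEval (a : Fin N → K) (k : ℕ) :
    MvPolynomial (Fin N) K →ₐ[K] MvPolynomial (Fin N) K :=
  aeval fun i => if (i : ℕ) < k then C (a i) else X i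

/-- The ideal generated by `X i - a i` for `i < k`. -/
noncomputable def pointIdeal (a : Fin N → K) (k : ℕ) : Ideal (MvPolynomial (Fin N) K) :=
  Ideal.span ((fun i => X i - C (a i)) '' {i : Fin N | (i : ℕ) < k})

lemma mem_pointIdeal_iff (a : Fin N → K) (k : ℕ) (p : MvPolynomial (Fin N) K) :
    p ∈ pointIdeal a k ↔ partialEval a k p = 0 := by
  have hle : pointIdeal a k ≤ RingHom.ker (partialEval a k) := by
    rw [pointIdeal, Ideal.span_le]
    rintro _ ⟨i, hi, rfl⟩
    have hi' : (i : ℕ) < k := hi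
    simp [partialEval, RingHom.mem_ker, hi', MvPolynomial.algebraMap_eq]
  have hsub : p - partialEval a k p ∈ pointIdeal a k := by
    have : (Ideal.Quotient.mkₐ K (pointIdeal a k)).comp (partialEval a k) =
        Ideal.Quotient.mkₐ K (pointIdeal a k) := by
      ext i
      by_cases hi : (i : ℕ) < k
      · simp only [partialEval, AlgHom.comp_apply, aeval_X, if_pos hi,
          Ideal.Quotient.mkₐ_eq_mk]
        refine (Ideal.Quotient.eq.2 ?_).symm
        exact Ideal.subset_span ⟨i, hi, rfl⟩
      · simp [partialEval, hi]
    exact Ideal.Quotient.eq.1 (DFunLike.congr_fun this p).symm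
  refine ⟨fun h => hle h, fun h => ?_⟩
  simpa [h] using hsub

lemma pointIdeal_succ (a : Fin N → K) (k : Fin N) :
    pointIdeal a (k + 1) = pointIdeal a k ⊔ Ideal.span {X k - C (a k)} := by
  have : {i : Fin N | (i : ℕ) < k + 1} = {i : Fin N | (i : ℕ) < k} ∪ {k} := by
    ext i
    simp only [Set.mem_ofPred_eq, Set.union_singleton, Set.mem_insert_iff, Fin.ext_iff]
    omega
  rw [pointIdeal, this, Set.image_union, Ideal.span_union, Set.image_singleton, pointIdeal]

lemma hasDepth_pointIdeal (a : Fin N → K) (j k : ℕ) (hjk : j + k = N) :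
    HasDepth (RingHom.ker (aeval a : MvPolynomial (Fin N) K →ₐ[K] K)) j (pointIdeal a k) := by
  induction j generalizing k with
  | zero =>
    obtain rfl : k = N := by omega
    refine ⟨1, by simp [mem_pointIdeal_iff], fun p hp => ?_⟩
    have : partialEval a k = (Algebra.ofId K _).comp (aeval a) := by
      ext i : 1
      simp [partialEval, Algebra.ofId_apply, MvPolynomial.algebraMap_eq]
    rw [mul_one, mem_pointIdeal_iff, this, AlgHom.comp_apply, show aeval a p = 0 from hp, map_zero]
  | succ j ih =>
    have hk : k < N := by omega
    have hsucc := pointIdeal_succ a ⟨k, hk⟩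
    refine ⟨X ⟨k, hk⟩ - C (a ⟨k, hk⟩), by simp [RingHom.mem_ker], fun y hy => ?_, ?_⟩
    · rw [mem_pointIdeal_iff, map_mul] at hy
      rw [mem_pointIdeal_iff]
      refine (mul_eq_zero.1 hy).resolve_left fun h0 => ?_
      have := congrArg (coeff (Finsupp.single ⟨k, hk⟩ 1)) h0
      simp [partialEval, MvPolynomial.algebraMap_eq, coeff_C,
        (Finsupp.single_ne_zero.2 one_ne_zero).symm] at this
    · rw [← hsucc]
      exact ih _ (by simp; omega)

lemma hasDepth_bot (a : Fin N → K) :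
    HasDepth (RingHom.ker (aeval a : MvPolynomial (Fin N) K →ₐ[K] K)) N ⊥ := by
  simpa [pointIdeal] using hasDepth_pointIdeal a N 0 (by simp)

lemma algebraicIndependent_cons {R : Type*} [CommRing R] [Algebra K R] {Q Q' : Ideal R}
    [Q.IsPrime] [Q'.IsPrime] (hle : Q ≤ Q') {x : R} (hxQ : x ∉ Q) (hxQ' : x ∈ Q') {k : ℕ}
    {b : Fin k → R} (hb : AlgebraicIndependent K (Ideal.Quotient.mk Q' ∘ b)) :
    AlgebraicIndependent K (Ideal.Quotient.mk Q ∘ (Fin.cons x b : Fin (k + 1) → R)) := by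
  have hcomp : ∀ (P : Ideal R) {n : ℕ} (c : Fin n → R) (p : MvPolynomial (Fin n) K),
      aeval (Ideal.Quotient.mk P ∘ c) p = Ideal.Quotient.mk P (aeval c p) := fun P n c p =>
    (comp_aeval_apply c (Ideal.Quotient.mkₐ K P) p).symm
  have key : ∀ (v : ℕ) (p : Polynomial (MvPolynomial (Fin k) K)), p.natDegree < v →
      Polynomial.eval₂ (aeval b : MvPolynomial (Fin k) K →ₐ[K] R).toRingHom x p ∈ Q → p = 0 := by
    intro v
    induction v with
    | zero => intro p hp; omega
    | succ v ih =>
      intro p hp hmem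
      have h0 : p.coeff 0 = 0 := by
        apply (injective_iff_map_eq_zero _).1 hb
        have : aeval b (p.coeff 0) ∈ Q' := by
          rw [← p.divX_mul_X_add] at hmem
          simp only [Polynomial.eval₂_add, Polynomial.eval₂_mul, Polynomial.eval₂_X,
            Polynomial.eval₂_C] at hmem
          exact (Ideal.add_mem_iff_right _ (Q'.mul_mem_left _ hxQ')).1 (hle hmem)
        rw [hcomp, Ideal.Quotient.eq_zero_iff_mem]
        exact this
      have hp' := p.divX_mul_X_add
      rw [h0, Polynomial.C_0, add_zero] at hp'
      rw [← hp', Polynomial.eval₂_mul, Polynomial.eval₂_X] at hmem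
      have := (Ideal.IsPrime.mem_or_mem ‹_› hmem).resolve_right hxQ
      by_cases hdeg : p.natDegree = 0
      · rw [Polynomial.eq_C_of_natDegree_eq_zero hdeg, h0, Polynomial.C_0]
      · rw [← hp', ih p.divX (by rw [Polynomial.natDegree_divX_eq_natDegree_tsub_one]; omega) this,
          zero_mul]
  rw [AlgebraicIndependent, injective_iff_map_eq_zero]
  intro p hp
  rw [hcomp, Ideal.Quotient.eq_zero_iff_mem] at hp
  have h1 : finSuccEquiv K k p = 0 := by
    refine key _ _ (Nat.lt_succ_self _) ?_
    convert hp using 1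
    have : (Polynomial.eval₂RingHom (aeval b : MvPolynomial (Fin k) K →ₐ[K] R).toRingHom x).comp
        (finSuccEquiv K k).toRingEquiv.toRingHom =
        (aeval (Fin.cons x b : Fin (k + 1) → R) :
          MvPolynomial (Fin (k + 1)) K →ₐ[K] R).toRingHom := by
      apply MvPolynomial.ringHom_ext
      · intro r
        simp [finSuccEquiv_apply, Polynomial.eval₂_C]
      · intro i
        refine Fin.cases ?_ (fun i => ?_) i <;>
        simp [finSuccEquiv_X_zero, finSuccEquiv_X_succ]
    exact DFunLike.congr_fun this p
  simpa using h1

lemma exists_algebraicIndependent_of_prime [IsAlgClosed K] {r k : ℕ}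
    {I : Ideal (MvPolynomial (Fin N) K)} (hI : IsGeneratedByRegular r I) (hrk : r + k = N)
    {Q : Ideal (MvPolynomial (Fin N) K)} [Q.IsPrime] {u : MvPolynomial (Fin N) K}
    (hu : ∀ a, a ∈ Q ↔ a * u ∈ I) :
    ∃ b : Fin k → MvPolynomial (Fin N) K, AlgebraicIndependent K (Ideal.Quotient.mk Q ∘ b) := by
  induction k generalizing r I Q u with
  | zero =>
    refine ⟨Fin.elim0, ?_⟩
    rw [algebraicIndependent_empty_type_iff]
    have := Ideal.Quotient.nontrivial_iff.2 (Ideal.IsPrime.ne_top ‹Q.IsPrime›)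
    exact (algebraMap K (MvPolynomial (Fin N) K ⧸ Q)).injective
  | succ k ih =>
    obtain ⟨n, hn, hQn⟩ := Ideal.exists_le_maximal Q (Ideal.IsPrime.ne_top ‹_›)
    obtain ⟨a, ha⟩ := MvPolynomial.isMaximal_iff_eq_vanishingIdeal_singleton.1 hn
    have hn' : n = RingHom.ker (aeval a : MvPolynomial (Fin N) K →ₐ[K] K) := by
      ext p
      simp [ha, RingHom.mem_ker]
    have hIQ : I ≤ Q := fun y hy => (hu y).2 (I.mul_mem_right _ hy)
    obtain ⟨k', hk', hd⟩ := hI.exists_hasDepth (n := n) (hn' ▸ hasDepth_bot a) (hIQ.trans hQn)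
    obtain rfl : k' = k + 1 := by omega
    obtain ⟨x, hxn, hx, -⟩ := hd
    have huI : u ∉ I := fun h => Ideal.IsPrime.ne_top ‹Q.IsPrime›
      ((Ideal.eq_top_iff_one _).2 ((hu 1).2 (by simpa using h)))
    have hxQ : x ∉ Q := fun h => huI (hx u ((hu x).1 h))
    have hv : ∃ v, (∀ q ∈ Q, q * v ∈ I) ∧ v ∉ I ⊔ Ideal.span {x} := by
      by_contra! hcon
      let W : Ideal (MvPolynomial (Fin N) K) :=
        { carrier := {v | ∀ q ∈ Q, q * v ∈ I}
          add_mem' := fun {a b} ha hb q hq => by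
            rw [mul_add]; exact I.add_mem (ha q hq) (hb q hq)
          zero_mem' := fun q _ => by simp
          smul_mem' := fun c v hv q hq => by
            rw [smul_eq_mul, mul_left_comm]; exact I.mul_mem_left _ (hv q hq) }
      have hW : Submodule.map I.mkQ W ≤ Ideal.span {x} • Submodule.map I.mkQ W := by
        rintro _ ⟨v, hv, rfl⟩
        obtain ⟨a, ha⟩ := mem_sup_span_singleton_iff.1 (hcon v hv)
        have haW : a ∈ W := fun q hq => hx _ <| by
          have := I.sub_mem (hv q hq) (I.mul_mem_left q ha)
          convert this using 1
          ring
        have : I.mkQ v = x • I.mkQ a := by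
          rw [← map_smul]
          exact (Submodule.Quotient.eq I).2 ha
        rw [this]
        exact Submodule.smul_mem_smul (Ideal.mem_span_singleton_self x)
          (Submodule.mem_map_of_mem haW)
      obtain ⟨c, hc, hcW⟩ := Submodule.exists_sub_one_mem_and_smul_eq_zero_of_fg_of_le_smul
        (Ideal.span {x}) (Submodule.map I.mkQ W) (IsNoetherian.noetherian _) hW
      have huW : u ∈ W := fun q hq => (hu q).1 hq
      have hcQ : c ∈ Q := by
        have := hcW _ (Submodule.mem_map_of_mem huW)
        rw [← map_smul] at this
        exact (hu c).2 ((Submodule.Quotient.mk_eq_zero I).1 this)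
      have hc' : c - 1 ∈ n := (Ideal.span_singleton_le_iff_mem n).2 hxn hc
      refine hn.ne_top ((Ideal.eq_top_iff_one _).2 ?_)
      simpa using n.sub_mem (hQn hcQ) hc'
    obtain ⟨v, hvQ, hvI⟩ := hv
    obtain ⟨Q', hQ', hle⟩ := exists_le_isAssociatedPrime_of_isNoetherianRing
      (MvPolynomial (Fin N) K) (Ideal.Quotient.mk (I ⊔ Ideal.span {x}) v)
      (by rwa [Ne, Ideal.Quotient.eq_zero_iff_mem])
    have hle' : ∀ a, a * v ∈ I ⊔ Ideal.span {x} → a ∈ Q' := by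
      intro a ha
      apply hle
      rw [Submodule.mem_colon_singleton, Submodule.mem_bot, Algebra.smul_def,
        Ideal.Quotient.algebraMap_eq, ← map_mul, Ideal.Quotient.eq_zero_iff_mem]
      exact ha
    have := hQ'.isPrime
    obtain ⟨u', hu'⟩ := hQ'.exists_mem_iff_mul_mem
    obtain ⟨b, hb⟩ := ih (hI.sup_span hx) (by omega) hu'
    refine ⟨Fin.cons x b, algebraicIndependent_cons (fun q hq => hle' q ?_) hxQ (hle' x ?_) hb⟩
    · exact Ideal.mem_sup_left (hvQ q hq)
    · exact Ideal.mem_sup_right (Ideal.mul_mem_right _ _ (Ideal.mem_span_singleton_self x))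

/-- If `g` is a zerodivisor modulo a weakly regular sequence of length `r`, then some prime ideal
containing `g` and the sequence has a residue ring of transcendence degree at least `N - r`. -/
lemma exists_prime_of_not_isSMulRegular [IsAlgClosed K] {gs : List (MvPolynomial (Fin N) K)}
    (hgs : RingTheory.Sequence.IsWeaklyRegular (MvPolynomial (Fin N) K) gs)
    {g : MvPolynomial (Fin N) K} (hg : ¬ IsRegularMod (Ideal.ofList gs) g) :
    ∃ Q : Ideal (MvPolynomial (Fin N) K), Q.IsPrime ∧ g ∈ Q ∧ (∀ f ∈ gs, f ∈ Q) ∧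
      ∃ (k : ℕ) (b : Fin k → MvPolynomial (Fin N) K), gs.length + k = N ∧
        AlgebraicIndependent K (Ideal.Quotient.mk Q ∘ b) := by
  have hg' : g ∈ {r : MvPolynomial (Fin N) K |
      IsSMulRegular (MvPolynomial (Fin N) K ⧸ Ideal.ofList gs) r}ᶜ :=
    fun h => hg (isSMulRegular_quotient_iff.1 h)
  rw [← biUnion_associatedPrimes_eq_compl_regular] at hg'
  simp only [Set.mem_iUnion] at hg'
  obtain ⟨Q, hQ, hgQ⟩ := hg'
  have hQ' : IsAssociatedPrime Q (MvPolynomial (Fin N) K ⧸ Ideal.ofList gs) := hQ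
  have := hQ'.isPrime
  obtain ⟨u, hu⟩ := hQ'.exists_mem_iff_mul_mem
  have hle : Ideal.ofList gs ≤ Q := fun y hy => (hu y).2 (Ideal.mul_mem_right _ _ hy)
  obtain ⟨n, hn, hQn⟩ := Ideal.exists_le_maximal Q (Ideal.IsPrime.ne_top ‹_›)
  obtain ⟨a, ha⟩ := MvPolynomial.isMaximal_iff_eq_vanishingIdeal_singleton.1 hn
  have hn' : n = RingHom.ker (aeval a : MvPolynomial (Fin N) K →ₐ[K] K) := by
    ext p
    simp [ha, RingHom.mem_ker]
  obtain ⟨k, hk, -⟩ := (isGeneratedByRegular_ofList hgs).exists_hasDepth (n := n)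
    (hn' ▸ hasDepth_bot a) (hle.trans hQn)
  obtain ⟨b, hb⟩ := exists_algebraicIndependent_of_prime (isGeneratedByRegular_ofList hgs) hk hu
  exact ⟨Q, this, hgQ, fun f hf => hle (Ideal.subset_span hf), k, b, hk, hb⟩

end PolynomialRing

section Separating

open IntermediateField
open scoped IntermediateField.algebraAdjoinAdjoin

/-- Every finite generating family of a field extension of a perfect field contains a separating
transcendence basis. -/
lemma exists_isTranscendenceBasis_isSeparable_adjoin_image {K L ι : Type*} [Field K] [Field L]
    [Algebra K L] [PerfectField K] [Finite ι] {a : ι → L} (ha : adjoin K (Set.range a) = ⊤) :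
    ∃ T : Set ι, IsTranscendenceBasis K (fun i : T => a i) ∧
      Algebra.IsSeparable (adjoin K (a '' T)) L := by
  have halg : Algebra.IsAlgebraic (Algebra.adjoin K (Set.range a)) L := by
    rw [← isAlgebraic_adjoin_iff_top, ha, Algebra.isAlgebraic_iff_isIntegral]
    exact Algebra.isIntegral_of_surjective topEquiv.surjective
  obtain ⟨T₀, hT₀⟩ : ∃ T : Set ι, IsTranscendenceBasis K (fun i : T => a i) := by
    obtain ⟨t, hts, ht⟩ := exists_isTranscendenceBasis_subset (R := K) (Set.range a)
    obtain ⟨T, -, hT⟩ := Set.SurjOn.exists_bijOn_subset (f := a) (s := Set.univ) (t := t)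
      (by rwa [Set.SurjOn, Set.image_univ])
    exact ⟨T, ht.comp_equiv (hT.equiv a)⟩
  obtain _ | ⟨p, hp, hpk⟩ := CharP.exists' K
  · refine ⟨T₀, hT₀, ?_⟩
    have : Algebra.IsAlgebraic (adjoin K (a '' T₀)) L := by
      have := hT₀.isAlgebraic_field
      convert! this <;> simp [Set.image_eq_range]
    infer_instance
  have : ExpChar K p := .prime hp.out
  have : CharP L p := .of_ringHom_of_ne_zero (algebraMap K L) p hp.out.ne_zero
  obtain ⟨T, hT, hmax⟩ := (Set.toFinite {T : Set ι | IsTranscendenceBasis K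
    (fun i : T => a i)}).exists_maximalFor
      (fun T => (separableClosure (adjoin K (a '' T)) L).restrictScalars K) _ ⟨T₀, hT₀⟩
  refine ⟨T, hT, ?_⟩
  rw [← separableClosure.eq_top_iff, ← (restrictScalars_injective K).eq_iff,
    restrictScalars_top, eq_top_iff, ← ha, adjoin_le_iff]
  rintro _ ⟨n, rfl⟩
  by_contra hn
  have hns : n ∉ T := fun h => hn (le_restrictScalars_separableClosure _
    (subset_adjoin _ _ ⟨n, h, rfl⟩))
  have ⟨i, hi₁, hi₂⟩ := exists_isTranscendenceBasis_and_isSeparable_of_linearIndepOn_pow'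
    p hp.out (a := a) (fun s hs => by
      refine hs.map_of_injective_injective (frobeniusEquiv K p).symm
        (frobenius L p).toAddMonoidHom (by simp) (by simp) fun r m => ?_
      change ((frobeniusEquiv K p).symm r • m) ^ p = r • m ^ p
      rw [Algebra.smul_def, Algebra.smul_def, mul_pow, ← map_pow, frobeniusEquiv_symm_pow_p])
    T n hT hns
  have hle : (separableClosure (adjoin K (a '' T)) L).restrictScalars K ≤
      (separableClosure (adjoin K (a '' (insert n T \ {i}))) L).restrictScalars K := by
    rw [separableClosure_le_separableClosure_iff, adjoin_le_iff]
    rintro _ ⟨j, hj, rfl⟩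
    obtain rfl | ne := eq_or_ne j i
    exacts [hi₂, le_restrictScalars_separableClosure _
      (subset_adjoin _ _ ⟨j, ⟨.inr hj, ne⟩, rfl⟩)]
  refine hn (hmax hi₁ hle ?_)
  obtain rfl | ne := eq_or_ne n i
  exacts [hi₂, le_restrictScalars_separableClosure _
    (subset_adjoin _ _ ⟨n, ⟨.inl rfl, ne⟩, rfl⟩)]

/-- A separable extension of a purely transcendental one can be lifted along nilpotent thickenings,
with prescribed values on the transcendence basis. -/
lemma AlgebraicIndependent.exists_lift {K L ι B : Type*} [Field K] [Field L] [Algebra K L]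
    {v : ι → L} (hv : AlgebraicIndependent K v) [Algebra.IsSeparable (adjoin K (Set.range v)) L]
    [CommRing B] [Algebra K B] (π : B →ₐ[K] L) (hπ : Function.Surjective π)
    (hker : IsNilpotent (RingHom.ker π)) (w : ι → B) (hw : ∀ i, π (w i) = v i) :
    ∃ σ : L →ₐ[K] B, (∀ z, π (σ z) = z) ∧ ∀ i, σ (v i) = w i := by
  let S := Algebra.adjoin K (Set.range v)
  have h1 : Algebra.FormallySmooth S (adjoin K (Set.range v)) :=
    .of_isLocalization (nonZeroDivisors _)
  have h2 : Algebra.FormallyEtale (adjoin K (Set.range v)) L :=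
    Algebra.FormallyEtale.of_isSeparable _ L
  have h3 : Algebra.FormallySmooth S L := .comp _ (adjoin K (Set.range v)) _
  let g : S →ₐ[K] B := (aeval w).comp hv.aevalEquiv.symm.toAlgHom
  have hg : ∀ i (h : v i ∈ S), g ⟨v i, h⟩ = w i := by
    intro i h
    have : (⟨v i, h⟩ : S) = hv.aevalEquiv (X i) := Subtype.ext (by simp)
    rw [this]
    simp [g]
  have hπg : ∀ s : S, π (g s) = s := by
    intro s
    obtain ⟨q, rfl⟩ := hv.aevalEquiv.surjective s
    simp only [g, AlgHom.comp_apply, AlgEquiv.coe_toAlgHom, AlgEquiv.symm_apply_apply]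
    rw [comp_aeval_apply]
    simp [hw]
  let _ : Algebra S B := g.toRingHom.toAlgebra
  have : IsScalarTower K S B := IsScalarTower.of_algebraMap_eq' g.comp_algebraMap.symm
  let π' : B →ₐ[S] L := { π with commutes' := hπg }
  let σ : L →ₐ[S] B := Algebra.FormallySmooth.liftOfSurjective (AlgHom.id S L) π' hπ hker
  refine ⟨σ.restrictScalars K, fun z => ?_, fun i => ?_⟩
  · exact Algebra.FormallySmooth.liftOfSurjective_apply (AlgHom.id S L) π' hπ hker z
  · have hmem : v i ∈ S := Algebra.subset_adjoin ⟨i, rfl⟩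
    exact (σ.commutes ⟨v i, hmem⟩).trans (hg i hmem)

/-- Formal solutions, to arbitrary order, of the equations satisfied by generators of a field
extension. -/
lemma exists_jet_of_adjoin_eq_top {K L : Type*} [Field K] [Field L] [Algebra K L] [PerfectField K]
    {N k : ℕ} {x : Fin N → L} (hx : adjoin K (Set.range x) = ⊤) {b : Fin k → L}
    (hb : AlgebraicIndependent K b) (d : ℕ) :
    ∃ (U : Finset (Fin N)) (y : Fin N → MvPolynomial (Fin N) L), U.card + k ≤ N ∧
      (∀ j, j ∉ U → y j = C (x j) + X j) ∧ (∀ j, constantCoeff (y j) = x j) ∧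
      ∀ p : MvPolynomial (Fin N) K, aeval x p = 0 →
        aeval y p ∈ idealOfVars (Fin N) L ^ (d + 1) := by
  classical
  obtain ⟨T, hT, hsep⟩ := exists_isTranscendenceBasis_isSeparable_adjoin_image hx
  have hcard : (T.toFinset)ᶜ.card + k ≤ N := by
    have h2 := hb.lift_cardinalMk_le_trdeg
    rw [← hT.lift_cardinalMk_eq_trdeg] at h2
    simp at h2
    have := T.toFinset.card_le_univ
    rw [Finset.card_compl]
    simp at this h2 ⊢
    omega
  have himg : Set.range (fun i : T => x i) = x '' T := (Set.image_eq_range _ _).symm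
  have hsep' : Algebra.IsSeparable (adjoin K (Set.range fun i : T => x i)) L := by
    rw [himg]; exact hsep
  let M := idealOfVars (Fin N) L ^ (d + 1)
  let B := MvPolynomial (Fin N) L ⧸ M
  let π₀ : MvPolynomial (Fin N) L →ₐ[K] L := (aeval (R := L) (fun _ => (0 : L))).restrictScalars K
  have hπ₀ : ∀ p, π₀ p = constantCoeff p := fun p => by
    simp [π₀, aeval_def]
  have hMker : idealOfVars (Fin N) L = RingHom.ker π₀ := by
    ext p
    rw [RingHom.mem_ker, hπ₀, ← pow_one (idealOfVars (Fin N) L), mem_pow_idealOfVars_iff']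
    simp [constantCoeff_eq, Finsupp.degree_eq_zero_iff]
  let π : B →ₐ[K] L := Ideal.Quotient.liftₐ M π₀ (fun p hp => by
    have := Ideal.pow_le_self (Nat.succ_ne_zero d) hp
    rwa [hMker] at this)
  have hπ : ∀ p : MvPolynomial (Fin N) L, π (Ideal.Quotient.mk M p) = constantCoeff p := hπ₀
  have hnil : IsNilpotent (RingHom.ker π) := by
    have hle : RingHom.ker π ≤ (idealOfVars (Fin N) L).map (Ideal.Quotient.mk M) := by
      intro z hz
      obtain ⟨z, rfl⟩ := Ideal.Quotient.mk_surjective z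
      refine Ideal.mem_map_of_mem _ ?_
      rw [hMker]
      exact hz
    refine ⟨d + 1, ?_⟩
    have := Ideal.pow_right_mono hle (d + 1)
    rw [← Ideal.map_pow, Ideal.map_quotient_self] at this
    exact le_bot_iff.1 this
  obtain ⟨σ, hσ, hσT⟩ := hT.1.exists_lift π (fun z => ⟨Ideal.Quotient.mk M (C z), by simp [hπ]⟩)
    hnil (fun i => Ideal.Quotient.mk M (C (x i) + X (i : Fin N))) (fun i => by simp [hπ])
  choose y₀ hy₀ using fun j => Ideal.Quotient.mk_surjective (I := M) (σ (x j))
  let y : Fin N → MvPolynomial (Fin N) L := fun j => if j ∈ T then C (x j) + X j else y₀ j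
  have hy : ∀ j, Ideal.Quotient.mk M (y j) = σ (x j) := by
    intro j
    by_cases hj : j ∈ T
    · simp only [y, if_pos hj]
      exact (hσT ⟨j, hj⟩).symm
    · simp only [y, if_neg hj, hy₀]
  refine ⟨(T.toFinset)ᶜ, y, hcard, fun j hj => ?_, fun j => ?_, fun p hp => ?_⟩
  · have : j ∈ T := by simpa using hj
    simp [y, this]
  · rw [← hπ, hy, hσ]
  · have h1 : Ideal.Quotient.mkₐ K M (aeval y p) = σ (aeval x p) := by
      refine (comp_aeval_apply y ((Ideal.Quotient.mkₐ L M).restrictScalars K) p).trans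
        (Eq.trans ?_ (comp_aeval_apply x σ p).symm)
      congr 2
      ext j
      exact hy j
    rw [hp, map_zero] at h1
    exact Ideal.Quotient.eq_zero_iff_mem.1 h1

/-- Formal solutions, to arbitrary order, of the equations in a prime ideal around its generic
point. -/
lemma exists_jet {K : Type u} [Field K] [PerfectField K] {N k : ℕ}
    (Q : Ideal (MvPolynomial (Fin N) K)) [Q.IsPrime] {b : Fin k → MvPolynomial (Fin N) K}
    (hb : AlgebraicIndependent K (Ideal.Quotient.mk Q ∘ b)) (d : ℕ) :
    ∃ (L : Type u) (_ : Field L) (_ : Algebra K L) (x : Fin N → L) (U : Finset (Fin N))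
      (y : Fin N → MvPolynomial (Fin N) L), U.card + k ≤ N ∧ (∀ p ∈ Q, aeval x p = 0) ∧
      (∀ j, j ∉ U → y j = C (x j) + X j) ∧ (∀ j, constantCoeff (y j) = x j) ∧
      ∀ p ∈ Q, aeval y p ∈ idealOfVars (Fin N) L ^ (d + 1) := by
  let L := FractionRing (MvPolynomial (Fin N) K ⧸ Q)
  let φ : MvPolynomial (Fin N) K →ₐ[K] L :=
    (IsScalarTower.toAlgHom K (MvPolynomial (Fin N) K ⧸ Q) L).comp (Ideal.Quotient.mkₐ K Q)
  let x : Fin N → L := fun j => φ (X j)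
  have hφ : φ = aeval x := by ext; simp [x]
  have hφQ : ∀ p, φ p = 0 ↔ p ∈ Q := by
    intro p
    rw [← Ideal.Quotient.eq_zero_iff_mem]
    exact (map_eq_zero_iff _ (IsFractionRing.injective (MvPolynomial (Fin N) K ⧸ Q) L))
  have htop : adjoin K (Set.range x) = ⊤ := by
    rw [eq_top_iff]
    rintro z -
    have hmem : ∀ p, φ p ∈ adjoin K (Set.range x) := by
      intro p
      rw [hφ]
      refine algebra_adjoin_le_adjoin K _ ?_
      rw [Algebra.adjoin_range_eq_range_aeval]
      exact ⟨p, rfl⟩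
    obtain ⟨p, q, hq, rfl⟩ := IsFractionRing.div_surjective (A := MvPolynomial (Fin N) K ⧸ Q) z
    obtain ⟨p, rfl⟩ := Ideal.Quotient.mk_surjective p
    obtain ⟨q, rfl⟩ := Ideal.Quotient.mk_surjective q
    exact div_mem (hmem p) (hmem q)
  have hbL := hb.map' (f := IsScalarTower.toAlgHom K (MvPolynomial (Fin N) K ⧸ Q) L)
    (IsFractionRing.injective (MvPolynomial (Fin N) K ⧸ Q) L)
  obtain ⟨U, y, hU, hyU, hy0, hy⟩ := exists_jet_of_adjoin_eq_top htop hbL d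
  have hQ : ∀ p ∈ Q, aeval x p = 0 := fun p hp => by rw [← hφ, hφQ]; exact hp
  exact ⟨L, inferInstance, inferInstance, x, U, y, hU, hQ, hyU, hy0, fun p hp => hy p (hQ p hp)⟩

end Separating

section Taylor

variable {R S σ : Type*} [CommRing R] [CommRing S] [Algebra R S]

/-- First order Taylor expansion of a polynomial. -/
lemma exists_aeval_add_mul_eq [Fintype σ] (f : MvPolynomial σ R) (c h : σ → S) (ε : S) :
    ∃ q, aeval (fun j => c j + ε * h j) f =
      aeval c f + ε * ∑ j, aeval c (pderiv j f) * h j + ε ^ 2 * q := by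
  classical
  induction f using MvPolynomial.induction_on with
  | C a => exact ⟨0, by simp⟩
  | add p q hp hq =>
    obtain ⟨a, ha⟩ := hp
    obtain ⟨b, hb⟩ := hq
    refine ⟨a + b, ?_⟩
    simp only [map_add, ha, hb, add_mul, Finset.sum_add_distrib]
    ring
  | mul_X p n hp =>
    obtain ⟨a, ha⟩ := hp
    refine ⟨a * (c n + ε * h n) + (∑ j, aeval c (pderiv j p) * h j) * h n, ?_⟩
    have : ∑ j, aeval c (pderiv j (p * X n)) * h j =
        (∑ j, aeval c (pderiv j p) * h j) * c n + aeval c p * h n := by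
      simp only [pderiv_mul, map_add, map_mul, aeval_X, add_mul, Finset.sum_add_distrib]
      congr 1
      · rw [Finset.sum_mul]
        exact Finset.sum_congr rfl fun j _ => by ring
      · rw [Finset.sum_eq_single n]
        · simp
        · intro j _ hj
          simp [pderiv_X_of_ne hj.symm]
        · simp
    rw [this, map_mul, map_mul, ha, aeval_X, aeval_X]
    ring

lemma coeff_aeval_C_mul_X (t : σ → S) (f : MvPolynomial σ R) (k : ℕ) :
    (aeval (fun j => Polynomial.C (t j) * Polynomial.X) f : Polynomial S).coeff k =
      aeval t (homogeneousComponent k f) := by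
  have hmon : ∀ m : σ →₀ ℕ, (aeval (fun j => Polynomial.C (t j) * Polynomial.X)
      (monomial m (1 : R)) : Polynomial S) =
      Polynomial.C (aeval t (monomial m (1 : R))) * Polynomial.X ^ m.degree := by
    intro m
    induction m using Finsupp.induction_linear with
    | zero => simp
    | add a b ha hb =>
      have : (monomial (a + b) (1 : R)) = monomial a 1 * monomial b 1 := by simp
      rw [this, map_mul, ha, hb, map_mul, map_add, map_mul, pow_add]
      ring
    | single i n => simp [← X_pow_eq_monomial, mul_pow, Finsupp.degree_single]
  induction f using MvPolynomial.induction_on' with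
  | add p q hp hq => rw [map_add, Polynomial.coeff_add, hp, hq, map_add, map_add]
  | monomial m a =>
    have : monomial m a = a • monomial m (1 : R) := by simp [smul_monomial]
    rw [this, map_smul, map_smul, hmon, map_smul, Polynomial.coeff_smul,
      Polynomial.coeff_C_mul, Polynomial.coeff_X_pow,
      homogeneousComponent_of_mem (isHomogeneous_monomial (n := m.degree) 1 rfl)]
    split_ifs with h <;> simp

lemma coeff_aeval_C_add_C_mul_X (a b : σ → S) {f : MvPolynomial σ R} {e : ℕ}
    (hf : f.totalDegree ≤ e) :
    (aeval (fun j => Polynomial.C (a j) + Polynomial.C (b j) * Polynomial.X) f :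
      Polynomial S).coeff e = aeval b (homogeneousComponent e f) := by
  have hmon : ∀ m : σ →₀ ℕ,
      (aeval (fun j => Polynomial.C (a j) + Polynomial.C (b j) * Polynomial.X)
        (monomial m (1 : R)) : Polynomial S).natDegree ≤ m.degree ∧
      (aeval (fun j => Polynomial.C (a j) + Polynomial.C (b j) * Polynomial.X)
        (monomial m (1 : R)) : Polynomial S).coeff m.degree = aeval b (monomial m (1 : R)) := by
    intro m
    induction m using Finsupp.induction_linear with
    | zero => simp
    | add m n hm hn =>
      have : (monomial (m + n) (1 : R)) = monomial m 1 * monomial n 1 := by simp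
      rw [this, map_mul, map_mul, map_add]
      refine ⟨Polynomial.natDegree_mul_le_of_le hm.1 hn.1, ?_⟩
      rw [Polynomial.coeff_mul_add_eq_of_natDegree_le hm.1 hn.1, hm.2, hn.2]
    | single i n =>
      have h1 : (Polynomial.C (a i) + Polynomial.C (b i) * Polynomial.X).natDegree ≤ 1 := by
        compute_degree
      rw [← X_pow_eq_monomial, map_pow, map_pow, aeval_X, aeval_X, Finsupp.degree_single]
      refine ⟨(Polynomial.natDegree_pow_le_of_le n h1).trans (by simp), ?_⟩
      have := Polynomial.coeff_pow_of_natDegree_le (m := n) h1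
      rw [mul_one] at this
      rw [this]
      simp [Polynomial.coeff_C]
  rw [homogeneousComponent_apply, map_sum]
  conv_lhs => rw [f.as_sum]
  rw [map_sum, Polynomial.finsetSum_coeff, Finset.sum_filter]
  refine Finset.sum_congr rfl fun m hm => ?_
  have : monomial m (coeff m f) = coeff m f • monomial m (1 : R) := by simp [smul_monomial]
  rw [this, map_smul, map_smul, Polynomial.coeff_smul]
  split_ifs with h
  · rw [← h, (hmon m).2]
  · have hle : m.degree ≤ e := (le_totalDegree (s := m) hm).trans hf
    rw [Polynomial.coeff_eq_zero_of_natDegree_lt ((hmon m).1.trans_lt (hle.lt_of_ne h)), smul_zero]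

lemma coeff_zero_aeval (a : σ → Polynomial S) (f : MvPolynomial σ R) :
    (aeval a f).coeff 0 = aeval (fun j => (a j).coeff 0) f := by
  induction f using MvPolynomial.induction_on with
  | C a => simp [Polynomial.coeff_C_zero, Polynomial.algebraMap_apply]
  | add p q hp hq => simp [hp, hq]
  | mul_X p n hp => simp [hp, Polynomial.mul_coeff_zero]

lemma aeval_sub_aeval_mem {I : Ideal S} {a b : σ → S} (h : ∀ j, a j - b j ∈ I)
    (f : MvPolynomial σ R) : aeval a f - aeval b f ∈ I := by
  rw [← Ideal.Quotient.eq]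
  have := comp_aeval_apply a (Ideal.Quotient.mkₐ R I) f
  have h' := comp_aeval_apply b (Ideal.Quotient.mkₐ R I) f
  simp only [Ideal.Quotient.mkₐ_eq_mk] at this h'
  rw [this, h']
  congr 2
  ext j
  exact Ideal.Quotient.eq.2 (h j)

lemma homogeneousComponent_mul_of_isHomogeneous {p q : MvPolynomial σ R} {m n : ℕ}
    (hp : p.IsHomogeneous m) (h : m ≤ n) :
    homogeneousComponent n (p * q) = p * homogeneousComponent (n - m) q := by
  let _ := gradedAlgebra (R := R) (σ := σ)
  have := DirectSum.coe_decompose_mul_of_left_mem_of_le (homogeneousSubmodule σ R) (b := q)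
    ((mem_homogeneousSubmodule m p).2 hp) h
  have key : ∀ (r : MvPolynomial σ R) i,
      (DirectSum.decompose (homogeneousSubmodule σ R) r i : MvPolynomial σ R) =
        homogeneousComponent i r := fun r i => decomposition.decompose'_apply r i
  rwa [key, key] at this

end Taylor

section Jet

variable {L : Type*} [CommRing L] {N : ℕ}

/-- The forms of degree less than `e` which collapse the leading forms of equations with singular
jets. -/
noncomputable def jetForm (y : Fin N → MvPolynomial (Fin N) L) (u : Fin N) (k : ℕ) :
    MvPolynomial (Fin N) L :=
  if k = 1 then X u - homogeneousComponent 1 (y u) else homogeneousComponent k (y u)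

lemma isHomogeneous_jetForm (y : Fin N → MvPolynomial (Fin N) L) (u : Fin N) (k : ℕ) :
    (jetForm y u k).IsHomogeneous k := by
  unfold jetForm
  split_ifs with h
  · subst h
    exact (isHomogeneous_X _ _).sub (homogeneousComponent_isHomogeneous _ _)
  · exact homogeneousComponent_isHomogeneous _ _

lemma aeval_homogeneousComponent_eq_zero {A : Type*} [CommRing A] [Algebra L A] (t : Fin N → A)
    {e : ℕ} (he : 0 < e) {f : MvPolynomial (Fin N) L}
    (hf : f.totalDegree ≤ e) {U : Finset (Fin N)} {x : Fin N → L}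
    {y : Fin N → MvPolynomial (Fin N) L} (hU : ∀ j ∈ U, aeval x (pderiv j f) = 0)
    (hyU : ∀ j, j ∉ U → y j = C (x j) + X j) (hy0 : ∀ j, constantCoeff (y j) = x j)
    (hy : aeval y f ∈ idealOfVars (Fin N) L ^ (e + 1))
    (ht : ∀ u ∈ U, ∀ k, 0 < k → k < e → aeval t (jetForm y u k) = 0) :
    aeval t (homogeneousComponent e f) = 0 := by
  classical
  obtain ⟨θ, hθ'⟩ : ∃ θ : MvPolynomial (Fin N) L →ₐ[L] Polynomial A,
    θ = aeval (fun j => Polynomial.C (t j) * Polynomial.X) := ⟨_, rfl⟩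
  have hθ : ∀ p k, (θ p).coeff k = aeval t (homogeneousComponent k p) := fun p k => by
    rw [hθ']
    exact coeff_aeval_C_mul_X t p k
  obtain ⟨I, hI⟩ : ∃ I : Ideal (Polynomial A), ∀ p, p ∈ I ↔ ∀ k < e + 1, p.coeff k = 0 :=
    ⟨Ideal.span {Polynomial.X ^ (e + 1)}, fun p => by
      rw [Ideal.mem_span_singleton, Polynomial.X_pow_dvd_iff]⟩
  let z : Fin N → A := fun j =>
    if j ∈ U then aeval t (homogeneousComponent e (y j) - if e = 1 then X j else 0) else 0
  let w : Fin N → Polynomial A := fun j =>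
    Polynomial.C (algebraMap L A (x j)) + Polynomial.C (t j) * Polynomial.X
  have hw : ∀ j, θ (y j) - (w j + Polynomial.X ^ e * Polynomial.C (z j)) ∈ I := by
    intro j
    by_cases hj : j ∈ U
    · rw [hI]
      intro k hk
      have hz : z j = aeval t (homogeneousComponent e (y j) - if e = 1 then X j else 0) :=
        if_pos hj
      have hfo : ∀ k, 0 < k → k < e →
        aeval t (homogeneousComponent k (y j)) = if k = 1 then t j else 0 := by
        intro k hk hke
        have := ht j hj k hk hke
        unfold jetForm at this
        split_ifs at this ⊢ with h1
        · subst h1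
          rw [map_sub, aeval_X, sub_eq_zero] at this
          exact this.symm
        · exact this
      have hc0 : aeval t (homogeneousComponent 0 (y j)) = algebraMap L A (x j) := by
        rw [homogeneousComponent_zero, ← constantCoeff_eq, hy0]
        simp
      simp only [Polynomial.coeff_sub, hθ, Polynomial.coeff_add, w, Polynomial.coeff_C,
        Polynomial.coeff_C_mul, Polynomial.coeff_X, Polynomial.coeff_mul_C, Polynomial.coeff_X_pow,
        hz]
      rcases Nat.eq_zero_or_pos k with rfl | hk0
      · rw [hc0]
        simp [he.ne]
      · rcases (Nat.lt_succ_iff.1 hk).lt_or_eq with hke | rfl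
        · rw [hfo k hk0 hke]
          simp [hke.ne, hk0.ne', eq_comm]
        · by_cases h1 : k = 1
          · subst h1
            simp
          · simp [h1, hk0.ne', Ne.symm h1]
    · have hz : z j = 0 := if_neg hj
      have : θ (y j) = w j := by
        rw [hyU j hj, hθ']
        simp [w, Polynomial.algebraMap_apply]
      rw [this, hz]
      simp
  have h1 : aeval (fun j => θ (y j)) f ∈ I := by
    rw [← comp_aeval_apply, hI]
    intro k hk
    rw [mem_pow_idealOfVars_iff'] at hy
    rw [hθ]
    have : homogeneousComponent k (aeval y f) = 0 := by
      ext m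
      rw [coeff_homogeneousComponent]
      split_ifs with hm
      · rw [hy m (by omega), coeff_zero]
      · rw [coeff_zero]
    rw [this, map_zero]
  have h2 := I.sub_mem h1 (aeval_sub_aeval_mem (a := fun j => θ (y j)) hw f)
  rw [sub_sub_cancel] at h2
  obtain ⟨q, hq⟩ := exists_aeval_add_mul_eq f w (fun j => Polynomial.C (z j)) (Polynomial.X ^ e)
  rw [hq, hI] at h2
  have h3 := h2 e (Nat.lt_succ_self e)
  rw [Polynomial.coeff_add, Polynomial.coeff_add, coeff_aeval_C_add_C_mul_X _ _ hf, ← pow_mul,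
    Polynomial.coeff_X_pow_mul' , Polynomial.coeff_X_pow_mul', if_pos le_rfl, if_neg (by omega),
    Nat.sub_self, Polynomial.finsetSum_coeff, Finset.sum_eq_zero, add_zero, add_zero] at h3
  · exact h3
  · intro j _
    rw [Polynomial.mul_coeff_zero, coeff_zero_aeval, Polynomial.coeff_C_zero]
    by_cases hj : j ∈ U
    · have : (fun j => (w j).coeff 0) = fun j => Algebra.ofId L A (x j) := by
        ext j
        simp [w, Algebra.ofId_apply]
      rw [this, ← comp_aeval_apply, hU j hj, map_zero, zero_mul]
    · rw [show z j = 0 from if_neg hj, mul_zero]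

lemma homogeneousComponent_mem_span_jetForm {e : ℕ} (he : 0 < e) {f : MvPolynomial (Fin N) L}
    (hf : f.totalDegree ≤ e) {U : Finset (Fin N)} {x : Fin N → L}
    {y : Fin N → MvPolynomial (Fin N) L} (hU : ∀ j ∈ U, aeval x (pderiv j f) = 0)
    (hyU : ∀ j, j ∉ U → y j = C (x j) + X j) (hy0 : ∀ j, constantCoeff (y j) = x j)
    (hy : aeval y f ∈ idealOfVars (Fin N) L ^ (e + 1)) :
    homogeneousComponent e f ∈ Ideal.span
      ((fun p : Fin N × ℕ => jetForm y p.1 p.2) '' (U ×ˢ Finset.Ioo 0 e : Finset (Fin N × ℕ))) := by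
  set J := Ideal.span
      ((fun p : Fin N × ℕ => jetForm y p.1 p.2) '' (U ×ˢ Finset.Ioo 0 e : Finset (Fin N × ℕ)))
    with hJ
  have hq : ∀ p : MvPolynomial (Fin N) L,
      aeval (fun j => Ideal.Quotient.mk J (X j)) p = Ideal.Quotient.mk J p := fun p => by
    have := comp_aeval_apply X (Ideal.Quotient.mkₐ L J) p
    rw [aeval_X_left_apply] at this
    exact this.symm
  rw [← Ideal.Quotient.eq_zero_iff_mem, ← hq]
  refine aeval_homogeneousComponent_eq_zero _ he hf hU hyU hy0 hy fun u hu k hk hke => ?_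
  rw [hq, Ideal.Quotient.eq_zero_iff_mem]
  exact Ideal.subset_span ⟨(u, k), by simp [hu, hk, hke], rfl⟩

end Jet

section Collapse

/-- The form `F i₀` of degree `g i₀` is a linear combination of the other forms of the same degree
plus a sum of products of forms of complementary degrees `q.2` and `g i₀ - q.2`, for `q ∈ S`. -/
def Collapses {R σ κ : Type*} [CommRing R] [Fintype κ] [DecidableEq κ]
    (F : κ → MvPolynomial σ R) (g : κ → ℕ) (i₀ : κ) (S : Finset (σ × ℕ)) : Prop :=
  ∃ (c : κ → R) (A H : σ × ℕ → MvPolynomial σ R),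
    (∀ q ∈ S, (A q).IsHomogeneous q.2) ∧ (∀ q ∈ S, (H q).IsHomogeneous (g i₀ - q.2)) ∧
    F i₀ = ∑ i with i ≠ i₀ ∧ g i = g i₀, C (c i) * F i + ∑ q ∈ S, A q * H q

lemma exists_algHom_of_finiteType (K B : Type*) [Field K] [IsAlgClosed K] [CommRing B]
    [Nontrivial B] [Algebra K B] [Algebra.FiniteType K B] : Nonempty (B →ₐ[K] K) := by
  obtain ⟨M, hM⟩ := Ideal.exists_maximal B
  let _ := Ideal.Quotient.field M
  have : Algebra.FiniteType K (B ⧸ M) :=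
    Algebra.FiniteType.of_surjective (Ideal.Quotient.mkₐ K M) Ideal.Quotient.mk_surjective
  have := finite_of_finite_type_of_isJacobsonRing K (B ⧸ M)
  have hbij := IsAlgClosed.algebraMap_bijective_of_isIntegral (k := K) (K := B ⧸ M)
  exact ⟨(AlgEquiv.ofBijective (Algebra.ofId K (B ⧸ M)) hbij).symm.toAlgHom.comp
    (Ideal.Quotient.mkₐ K M)⟩

lemma exists_specialization {K L σ : Type*} [Field K] [IsAlgClosed K] [CommRing L] [Nontrivial L]
    [Algebra K L] {T : Set (MvPolynomial σ L)} (hT : T.Finite) :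
    ∃ (B : Subalgebra K L) (_ : B →ₐ[K] K),
      ∀ p ∈ T, p ∈ Set.range (map (σ := σ) (algebraMap B L)) := by
  classical
  let E : Finset L := hT.toFinset.biUnion fun p => p.coeffs
  have : Algebra.FiniteType K (Algebra.adjoin K (E : Set L)) :=
    (Subalgebra.fg_iff_finiteType _).1 ⟨E, rfl⟩
  obtain ⟨φ⟩ := exists_algHom_of_finiteType K (Algebra.adjoin K (E : Set L))
  refine ⟨_, φ, fun p hp => mem_range_map_iff_coeffs_subset.2 fun a ha => ?_⟩
  exact ⟨⟨a, Algebra.subset_adjoin (Finset.mem_coe.2 (Finset.mem_biUnion.2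
    ⟨p, hT.mem_toFinset.2 hp, ha⟩))⟩, rfl⟩

lemma Collapses.of_map_algebraMap {K L σ κ : Type*} [Field K] [IsAlgClosed K] [CommRing L]
    [Nontrivial L] [Algebra K L] [Fintype κ] [DecidableEq κ] {F : κ → MvPolynomial σ K}
    {g : κ → ℕ} {i₀ : κ} {S : Finset (σ × ℕ)}
    (h : Collapses (fun i => map (algebraMap K L) (F i)) g i₀ S) : Collapses F g i₀ S := by
  classical
  obtain ⟨c, A, H, hA, hH, hF⟩ := h
  obtain ⟨B, φ, hB⟩ := exists_specialization (K := K)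
    (T := Set.range (fun i => C (c i)) ∪ (A '' S ∪ H '' S))
    ((Set.finite_range _).union ((S.finite_toSet.image _).union (S.finite_toSet.image _)))
  have hinj : Function.Injective (algebraMap B L) := Subtype.val_injective
  choose! ψ hψ using hB
  have hc : ∀ i, map (algebraMap B L) (ψ (C (c i))) = C (c i) := fun i =>
    hψ _ (Or.inl ⟨i, rfl⟩)
  have hA' : ∀ q ∈ S, map (algebraMap B L) (ψ (A q)) = A q := fun q hq =>
    hψ _ (Or.inr (Or.inl ⟨q, hq, rfl⟩))
  have hH' : ∀ q ∈ S, map (algebraMap B L) (ψ (H q)) = H q := fun q hq =>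
    hψ _ (Or.inr (Or.inr ⟨q, hq, rfl⟩))
  have hcC : ∀ i, ψ (C (c i)) = C (coeff 0 (ψ (C (c i)))) := fun i => by
    apply map_injective _ hinj
    rw [map_C, hc, ← coeff_map, hc, coeff_C, if_pos rfl]
  refine ⟨fun i => φ (coeff 0 (ψ (C (c i)))), fun q => map (φ : B →+* K) (ψ (A q)),
    fun q => map (φ : B →+* K) (ψ (H q)), fun q hq => ?_, fun q hq => ?_, ?_⟩
  · exact IsHomogeneous.map (IsHomogeneous.of_map hinj (by rw [hA' q hq]; exact hA q hq)) _
  · exact IsHomogeneous.map (IsHomogeneous.of_map hinj (by rw [hH' q hq]; exact hH q hq)) _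
  · have hFB : map (algebraMap K B) (F i₀) =
        ∑ i with i ≠ i₀ ∧ g i = g i₀, ψ (C (c i)) * map (algebraMap K B) (F i) +
          ∑ q ∈ S, ψ (A q) * ψ (H q) := by
      apply map_injective _ hinj
      simp only [map_add, map_sum, map_mul, map_map, ← IsScalarTower.algebraMap_eq, hc]
      refine hF.trans ?_
      congr 1
      exact Finset.sum_congr rfl fun q hq => by rw [hA' q hq, hH' q hq]
    have hφ : ((φ : B →+* K).comp (algebraMap K B)) = RingHom.id K := by
      ext a
      exact φ.commutes a
    have := congrArg (map (φ : B →+* K)) hFB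
    simp only [map_add, map_sum, map_mul, map_map, hφ, map_id] at this
    rw [this]
    congr 1
    exact Finset.sum_congr rfl fun i _ => by rw [hcC i, map_C]; simp

lemma exists_collapses_of_jet {L : Type*} [Field L] {N d : ℕ} {κ : Type*} [Fintype κ]
    [DecidableEq κ] {F : κ → MvPolynomial (Fin N) L} {g : κ → ℕ}
    (hF : ∀ i, (F i).IsHomogeneous (g i)) (hg0 : ∀ i, 0 < g i) (hgd : ∀ i, g i ≤ d)
    {U : Finset (Fin N)} (hUκ : U.card < Fintype.card κ) {x : Fin N → L}
    {y : Fin N → MvPolynomial (Fin N) L} (hyU : ∀ j, j ∉ U → y j = C (x j) + X j)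
    (hy0 : ∀ j, constantCoeff (y j) = x j)
    (hy : ∀ i, aeval y (F i) ∈ idealOfVars (Fin N) L ^ (d + 1)) :
    ∃ i₀, Collapses F g i₀ (U ×ˢ Finset.Ioo 0 (g i₀)) := by
  classical
  let Φ : (κ → L) →ₗ[L] (U → L) := LinearMap.pi fun j =>
    ∑ i, aeval x (pderiv j.1 (F i)) • LinearMap.proj i
  obtain ⟨c, hc, hc0⟩ := (Submodule.ne_bot_iff _).1 (LinearMap.ker_ne_bot_of_finrank_lt (f := Φ)
    (by simpa using hUκ))
  have hsupp : (Finset.univ.filter fun i => c i ≠ 0).Nonempty := by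
    obtain ⟨i, hi⟩ := Function.ne_iff.1 hc0
    exact ⟨i, by simpa using hi⟩
  obtain ⟨i₀, hi₀, hmax⟩ := Finset.exists_max_image _ g hsupp
  replace hi₀ : c i₀ ≠ 0 := by simpa using hi₀
  replace hmax : ∀ i, c i ≠ 0 → g i ≤ g i₀ := fun i hi => hmax i (by simpa using hi)
  let f : MvPolynomial (Fin N) L := ∑ i, C (c i) * F i
  have hdeg : f.totalDegree ≤ g i₀ := by
    refine totalDegree_finsetSum_le fun i _ => ?_
    by_cases hi : c i = 0
    · simp [hi]
    · refine (totalDegree_mul _ _).trans ?_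
      rw [totalDegree_C, zero_add]
      exact (hF i).totalDegree_le.trans (hmax i hi)
  have hder : ∀ j ∈ U, aeval x (pderiv j f) = 0 := by
    intro j hj
    have := congrFun (LinearMap.mem_ker.1 hc) ⟨j, hj⟩
    simp only [Φ, LinearMap.pi_apply, LinearMap.sum_apply, LinearMap.smul_apply,
      LinearMap.proj_apply, Pi.zero_apply, smul_eq_mul] at this
    rw [← this]
    simp only [f, map_sum, pderiv_C_mul, map_mul, aeval_C, Algebra.algebraMap_self,
      RingHom.id_apply]
    exact Finset.sum_congr rfl fun i _ => mul_comm _ _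
  have hjet : aeval y f ∈ idealOfVars (Fin N) L ^ (g i₀ + 1) := by
    simp only [f, map_sum, map_mul]
    refine Ideal.sum_mem _ fun i _ => Ideal.mul_mem_left _ _ ?_
    exact Ideal.pow_le_pow_right (Nat.succ_le_succ (hgd i₀)) (hy i)
  have hmem := homogeneousComponent_mem_span_jetForm (hg0 i₀) hdeg hder hyU hy0 hjet
  obtain ⟨H, hH⟩ := Submodule.mem_span_image_finset_iff_exists_fun' _ |>.1 hmem
  have hH' : homogeneousComponent (g i₀) f = ∑ q ∈ U ×ˢ Finset.Ioo 0 (g i₀),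
      jetForm y q.1 q.2 * homogeneousComponent (g i₀ - q.2) (H q) := by
    have := congrArg (homogeneousComponent (g i₀)) hH
    rw [homogeneousComponent_of_mem (homogeneousComponent_isHomogeneous _ _), if_pos rfl,
      map_sum] at this
    rw [← this]
    refine Finset.sum_congr rfl fun q hq => ?_
    rw [smul_eq_mul, mul_comm, homogeneousComponent_mul_of_isHomogeneous
      (isHomogeneous_jetForm y q.1 q.2)]
    exact (Finset.mem_Ioo.1 (Finset.mem_product.1 hq).2).2.le
  have hfe : homogeneousComponent (g i₀) f = C (c i₀) * F i₀ +
      ∑ i with i ≠ i₀ ∧ g i = g i₀, C (c i) * F i := by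
    have : homogeneousComponent (g i₀) f = ∑ i with g i = g i₀, C (c i) * F i := by
      rw [Finset.sum_filter, map_sum]
      refine Finset.sum_congr rfl fun i _ => ?_
      rw [homogeneousComponent_C_mul, homogeneousComponent_of_mem (hF i)]
      by_cases h : g i = g i₀
      · simp [h]
      · simp [h, Ne.symm h]
    rw [this, ← Finset.add_sum_erase _ _ (a := i₀) (by simp)]
    congr 2
    ext i
    simp
  refine ⟨i₀, fun i => - ((c i₀)⁻¹ * c i), fun q => C (c i₀)⁻¹ * jetForm y q.1 q.2,
    fun q => homogeneousComponent (g i₀ - q.2) (H q), fun q _ => ?_, fun q _ =>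
    homogeneousComponent_isHomogeneous _ _, ?_⟩
  · exact (isHomogeneous_jetForm y q.1 q.2).C_mul _
  · dsimp only
    have hcc : (C (c i₀)⁻¹ * C (c i₀) : MvPolynomial (Fin N) L) = 1 := by
      rw [← C_mul, inv_mul_cancel₀ hi₀, C_1]
    rw [hH'] at hfe
    simp only [mul_assoc, ← Finset.mul_sum, hfe, map_neg, C_mul, neg_mul, Finset.sum_neg_distrib]
    linear_combination (-F i₀) * hcc

end Collapse

section Descent

lemma Collapses.of_comp_injective {R σ κ κ' : Type*} [CommRing R] [Fintype κ] [DecidableEq κ]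
    [Fintype κ'] [DecidableEq κ'] {F : κ → MvPolynomial σ R} {g : κ → ℕ} {ι : κ' → κ}
    (hι : Function.Injective ι) {i₀ : κ'} {S : Finset (σ × ℕ)}
    (h : Collapses (F ∘ ι) (g ∘ ι) i₀ S) : Collapses F g (ι i₀) S := by
  obtain ⟨c, A, H, hA, hH, hF⟩ := h
  refine ⟨Function.extend ι c 0, A, H, hA, hH, hF.trans ?_⟩
  congr 1
  rw [Finset.sum_filter, Finset.sum_filter]
  refine Fintype.sum_of_injective ι hι _ _ (fun i hi => ?_) (fun i => ?_)
  · rw [Function.extend_apply' _ _ _ hi]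
    simp
  · simp [hι.extend_apply, hι.ne_iff]

lemma exists_append_singleton_prefix {R : Type*} [CommRing R] {rs : List R}
    (h : ¬ RingTheory.Sequence.IsWeaklyRegular R rs) :
    ∃ gs g, gs ++ [g] <+: rs ∧ RingTheory.Sequence.IsWeaklyRegular R gs ∧
      ¬ IsRegularMod (Ideal.ofList gs) g := by
  induction rs using List.reverseRecOn with
  | nil => exact (h (RingTheory.Sequence.IsWeaklyRegular.nil R R)).elim
  | append_singleton rs x ih =>
    by_cases hrs : RingTheory.Sequence.IsWeaklyRegular R rs
    · refine ⟨rs, x, List.prefix_rfl, hrs, fun hx => h ?_⟩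
      rw [RingTheory.Sequence.isWeaklyRegular_append_iff]
      refine ⟨hrs, ?_⟩
      rwa [RingTheory.Sequence.isWeaklyRegular_singleton_iff, smul_eq_mul, Ideal.mul_top,
        isSMulRegular_quotient_iff]
    · obtain ⟨gs, g, hpre, hgs, hg⟩ := ih hrs
      exact ⟨gs, g, hpre.trans (List.prefix_append _ _), hgs, hg⟩

/-- A sequence of forms of positive degree over an algebraically closed field that is not weakly
regular contains a form that collapses. -/
lemma exists_collapses {K : Type u} [Field K] [IsAlgClosed K] {N s : ℕ}
    {F : Fin s → MvPolynomial (Fin N) K} {g : Fin s → ℕ} (hF : ∀ i, (F i).IsHomogeneous (g i))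
    (hg0 : ∀ i, 0 < g i)
    (h : ¬ RingTheory.Sequence.IsWeaklyRegular (MvPolynomial (Fin N) K) (List.ofFn F)) :
    ∃ i₀, ∃ U : Finset (Fin N), U.card ≤ s ∧ Collapses F g i₀ (U ×ˢ Finset.Ioo 0 (g i₀)) := by
  obtain ⟨gs, f, hpre, hgs, hf⟩ := exists_append_singleton_prefix h
  obtain ⟨Q, hQ, hfQ, hgsQ, k, b, hk, hb⟩ := exists_prime_of_not_isSMulRegular hgs hf
  have hlen : gs.length + 1 ≤ s := by simpa using hpre.length_le
  have hFQ : ∀ i : Fin (gs.length + 1), F (Fin.castLE hlen i) ∈ Q := by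
    intro i
    have hi : (i : ℕ) < (gs ++ [f]).length := by simp [Nat.lt_succ_iff.1 i.2]
    have h1 : (gs ++ [f])[(i : ℕ)] = F (Fin.castLE hlen i) := by
      rw [hpre.getElem hi]
      simp [Fin.castLE]
    rw [← h1]
    have := List.getElem_mem hi
    rcases List.mem_append.1 this with h2 | h2
    · exact hgsQ _ h2
    · rw [List.mem_singleton.1 h2]
      exact hfQ
  obtain ⟨L, _, _, x, U, y, hU, -, hyU, hy0, hy⟩ := exists_jet Q hb (∑ i, g i)
  have hUr : U.card ≤ gs.length := by omega
  obtain ⟨i₀, hi₀⟩ := exists_collapses_of_jet (L := L) (d := ∑ i, g i)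
    (F := fun i => map (algebraMap K L) ((F ∘ Fin.castLE hlen) i)) (g := g ∘ Fin.castLE hlen)
    (fun i => (hF _).map _) (fun i => hg0 _)
    (fun i => Finset.single_le_sum (f := g) (fun _ _ => Nat.zero_le _) (Finset.mem_univ _))
    (U := U) (by simpa using Nat.lt_succ_of_le hUr) hyU hy0 (fun i => by
      rw [aeval_map_algebraMap]
      exact hy _ (hFQ i))
  exact ⟨Fin.castLE hlen i₀, U, by omega,
    hi₀.of_map_algebraMap.of_comp_injective (Fin.castLE_injective hlen)⟩

lemma isRegular_of_isHomogeneous {K : Type*} [Field K] {N s : ℕ}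
    {G : Fin s → MvPolynomial (Fin N) K} (hG : ∀ j, ∃ e, 0 < e ∧ (G j).IsHomogeneous e)
    (h : RingTheory.Sequence.IsWeaklyRegular (MvPolynomial (Fin N) K) (List.ofFn G)) :
    RingTheory.Sequence.IsRegular (MvPolynomial (Fin N) K) (List.ofFn G) := by
  refine ⟨h, fun htop => ?_⟩
  rw [smul_eq_mul, Ideal.mul_top] at htop
  have hle : Ideal.ofList (List.ofFn G) ≤ RingHom.ker (constantCoeff (R := K) (σ := Fin N)) := by
    refine Ideal.span_le.2 fun p hp => ?_
    obtain ⟨j, rfl⟩ := List.mem_ofFn.1 hp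
    obtain ⟨e, he, hGe⟩ := hG j
    rw [SetLike.mem_coe, RingHom.mem_ker, constantCoeff_eq]
    exact hGe.coeff_eq_zero (by simpa using he.ne)
  exact RingHom.ker_ne_top (constantCoeff (R := K) (σ := Fin N)) (top_le_iff.1 (htop.le.trans hle))

/-- Any family of at most `δ i` forms of degree `i + 1` over an algebraically closed field is
contained in an algebra generated by a regular sequence of at most `n` forms. -/
def HasRegularBound {d : ℕ} (δ : Fin d → ℕ) (n : ℕ) : Prop :=
  ∀ (K : Type u) [Field K] [IsAlgClosed K] (N : ℕ) (S : Fin d → Finset (MvPolynomial (Fin N) K)),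
    (∀ i, ∀ f ∈ S i, f.IsHomogeneous ((i : ℕ) + 1)) → (∀ i, (S i).card ≤ δ i) →
    ∃ (s : ℕ) (G : Fin s → MvPolynomial (Fin N) K), s ≤ n ∧
      (∀ j, ∃ e : ℕ, 0 < e ∧ e ≤ d ∧ (G j).IsHomogeneous e) ∧
      RingTheory.Sequence.IsRegular (MvPolynomial (Fin N) K) (List.ofFn G) ∧
      ∀ i, ∀ f ∈ S i, f ∈ Algebra.adjoin K (Set.range G)

/-- The dimension sequence after a form of degree `e + 1` has been replaced by forms of smaller
degree. -/
def collapseSequence {d : ℕ} (δ : Fin d → ℕ) (e i : Fin d) : ℕ :=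
  if i < e then δ i + 2 * ∑ j, δ j else if i = e then δ i - 1 else δ i

lemma card_filter_product_le {α β : Type*} [DecidableEq α] (U : Finset α) (T : Finset β)
    (p : β → Prop) [DecidablePred p] (hp : ∀ a b, p a → p b → a ∈ T → b ∈ T → a = b) :
    ((U ×ˢ T).filter fun q => p q.2).card ≤ U.card := by
  refine Finset.card_le_card_of_injOn Prod.fst (fun q hq => ?_) fun q hq q' hq' h => ?_
  · simp only [Finset.coe_filter, Finset.mem_product, Set.mem_ofPred_eq] at hq
    exact hq.1.1
  · simp only [Finset.coe_filter, Finset.mem_product, Set.mem_ofPred_eq] at hq hq'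
    exact Prod.ext h (hp _ _ hq.2 hq'.2 hq.1.2 hq'.1.2)

lemma exists_regularSequence_or_collapse {K : Type u} [Field K] [IsAlgClosed K] {N d : ℕ}
    {δ : Fin d → ℕ} {S : Fin d → Finset (MvPolynomial (Fin N) K)}
    (hS : ∀ i, ∀ f ∈ S i, f.IsHomogeneous ((i : ℕ) + 1)) (hδ : ∀ i, (S i).card ≤ δ i) :
    (∃ (s : ℕ) (G : Fin s → MvPolynomial (Fin N) K), s ≤ ∑ i, δ i ∧
      (∀ j, ∃ e : ℕ, 0 < e ∧ e ≤ d ∧ (G j).IsHomogeneous e) ∧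
      RingTheory.Sequence.IsRegular (MvPolynomial (Fin N) K) (List.ofFn G) ∧
      ∀ i, ∀ f ∈ S i, f ∈ Algebra.adjoin K (Set.range G)) ∨
    ∃ e, 0 < δ e ∧ ∃ S' : Fin d → Finset (MvPolynomial (Fin N) K),
      (∀ i, ∀ f ∈ S' i, f.IsHomogeneous ((i : ℕ) + 1)) ∧
      (∀ i, (S' i).card ≤ collapseSequence δ e i) ∧
      ∀ B : Subalgebra K (MvPolynomial (Fin N) K), (∀ i, ∀ f ∈ S' i, f ∈ B) →
        ∀ i, ∀ f ∈ S i, f ∈ B := by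
  classical
  let κ := Σ i, S i
  let ε : κ ≃ Fin (Fintype.card κ) := Fintype.equivFin κ
  have hcard : Fintype.card κ ≤ ∑ i, δ i := by
    rw [Fintype.card_sigma]
    exact Finset.sum_le_sum fun i _ => by simpa using hδ i
  let F : Fin (Fintype.card κ) → MvPolynomial (Fin N) K := fun a => ((ε.symm a).2 : _)
  let g : Fin (Fintype.card κ) → ℕ := fun a => (ε.symm a).1 + 1
  have hFg : ∀ a, (F a).IsHomogeneous (g a) := fun a => hS _ _ (ε.symm a).2.2
  by_cases hreg : RingTheory.Sequence.IsWeaklyRegular (MvPolynomial (Fin N) K) (List.ofFn F)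
  · refine Or.inl ⟨_, F, hcard, fun j => ⟨g j, Nat.succ_pos _, (ε.symm j).1.2, hFg j⟩,
      isRegular_of_isHomogeneous (fun j => ⟨g j, Nat.succ_pos _, hFg j⟩) hreg, fun i f hf => ?_⟩
    exact Algebra.subset_adjoin ⟨ε ⟨i, f, hf⟩,
      congrArg (fun a : κ => (a.2 : MvPolynomial (Fin N) K)) (ε.symm_apply_apply _)⟩
  · right
    obtain ⟨a₀, U, hU, c, A, H, hA, hH, hF⟩ :=
      exists_collapses hFg (fun _ => Nat.succ_pos _) hreg
    obtain ⟨e, he⟩ : ∃ e, e = (ε.symm a₀).1 := ⟨_, rfl⟩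
    have hg : g a₀ = e + 1 := by rw [he]
    have hFe : F a₀ ∈ S e := by
      rw [he]
      exact (ε.symm a₀).2.2
    rw [hg] at hA hH hF
    set T := U ×ˢ Finset.Ioo 0 ((e : ℕ) + 1) with hT
    have hUδ : U.card ≤ ∑ i, δ i := hU.trans hcard
    let S₁ : Fin d → Finset (MvPolynomial (Fin N) K) := fun i =>
      (T.filter fun q => q.2 = (i : ℕ) + 1).image A
    let S₂ : Fin d → Finset (MvPolynomial (Fin N) K) := fun i =>
      (T.filter fun q => (e : ℕ) + 1 - q.2 = (i : ℕ) + 1).image H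
    have hS₁ : ∀ i, (S₁ i).card ≤ ∑ i, δ i := fun i =>
      Finset.card_image_le.trans ((card_filter_product_le U _ (fun k => k = (i : ℕ) + 1)
        (by rintro a b rfl rfl - -; rfl)).trans hUδ)
    have hS₂ : ∀ i, (S₂ i).card ≤ ∑ i, δ i := fun i =>
      Finset.card_image_le.trans ((card_filter_product_le U _
        (fun k => (e : ℕ) + 1 - k = (i : ℕ) + 1)
        (fun a b ha hb _ _ => by omega)).trans hUδ)
    refine ⟨e, (Finset.card_pos.2 ⟨_, hFe⟩).trans_le (hδ e), fun i =>
      if i < e then S i ∪ (S₁ i ∪ S₂ i) else if i = e then (S i).erase (F a₀) else S i,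
      fun i f hf => ?_, fun i => ?_, fun B hB => ?_⟩
    · dsimp only at hf
      split_ifs at hf with h1 h2
      · simp only [Finset.mem_union, S₁, S₂, Finset.mem_image, Finset.mem_filter] at hf
        rcases hf with hf | ⟨q, ⟨hq, hqi⟩, rfl⟩ | ⟨q, ⟨hq, hqi⟩, rfl⟩
        · exact hS i f hf
        · rw [← hqi]
          exact hA q hq
        · rw [← hqi]
          exact hH q hq
      · exact hS i f (Finset.mem_of_mem_erase hf)
      · exact hS i f hf
    · unfold collapseSequence
      dsimp only
      split_ifs with h1 h2
      · have := Finset.card_union_le (S i) (S₁ i ∪ S₂ i)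
        have := Finset.card_union_le (S₁ i) (S₂ i)
        have := hδ i
        have := hS₁ i
        have := hS₂ i
        omega
      · subst h2
        rw [Finset.card_erase_of_mem hFe]
        exact Nat.sub_le_sub_right (hδ i) 1
      · exact hδ i
    · dsimp only at hB
      have hSB : ∀ i, ∀ f ∈ S i, f ≠ F a₀ ∨ i ≠ e → f ∈ B := by
        intro i f hf hne
        refine hB i f ?_
        split_ifs with h1 h2
        · exact Finset.mem_union_left _ hf
        · exact Finset.mem_erase.2 ⟨hne.resolve_right (not_not.2 h2), hf⟩
        · exact hf
      have hlow : ∀ k, 0 < k → k < (e : ℕ) + 1 → ∃ i : Fin d, i < e ∧ k = i + 1 :=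
        fun k hk hke => ⟨⟨k - 1, by omega⟩, Fin.lt_def.2 (by dsimp only; omega),
          by dsimp only; omega⟩
      have hAB : ∀ q ∈ T, A q ∈ B := by
        intro q hq
        have hk := Finset.mem_Ioo.1 (Finset.mem_product.1 hq).2
        obtain ⟨i, hi, hki⟩ := hlow q.2 hk.1 hk.2
        refine hB i _ ?_
        rw [if_pos hi]
        exact Finset.mem_union_right _ (Finset.mem_union_left _
          (Finset.mem_image_of_mem _ (Finset.mem_filter.2 ⟨hq, hki⟩)))
      have hHB : ∀ q ∈ T, H q ∈ B := by
        intro q hq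
        have hk := Finset.mem_Ioo.1 (Finset.mem_product.1 hq).2
        obtain ⟨i, hi, hki⟩ := hlow (e + 1 - q.2) (by omega) (by omega)
        refine hB i _ ?_
        rw [if_pos hi]
        exact Finset.mem_union_right _ (Finset.mem_union_right _
          (Finset.mem_image_of_mem _ (Finset.mem_filter.2 ⟨hq, hki⟩)))
      have hFB : F a₀ ∈ B := by
        rw [hF]
        refine B.add_mem (B.sum_mem fun a ha => B.mul_mem (B.algebraMap_mem (c a)) ?_)
          (B.sum_mem fun q hq => B.mul_mem (hAB q hq) (hHB q hq))
        obtain ⟨ha, hga⟩ := (Finset.mem_filter.1 ha).2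
        refine hSB (ε.symm a).1 _ (ε.symm a).2.2 ?_
        by_contra! hcon
        refine ha (ε.symm.injective (Sigma.ext (hcon.2.trans he) ?_))
        exact (Subtype.heq_iff_coe_eq (fun f => by rw [hcon.2, he])).2 hcon.1
      intro i f hf
      by_cases hf' : f = F a₀
      · rw [hf']
        exact hFB
      · exact hSB i f hf (Or.inl hf')

lemma exists_hasRegularBound {d : ℕ} (δ : Fin d → ℕ) : ∃ n, HasRegularBound.{u} δ n := by
  have hwf : WellFounded (Pi.Lex (fun i j : Fin d => j < i) fun {_ : Fin d} (a b : ℕ) => a < b) :=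
    Pi.Lex.wellFounded _ fun _ => wellFounded_lt
  induction δ using hwf.induction with
  | _ δ ih =>
    have hstep : ∀ e, ∃ n, 0 < δ e → HasRegularBound.{u} (collapseSequence δ e) n := by
      intro e
      by_cases he : 0 < δ e
      · obtain ⟨n, hn⟩ := ih (collapseSequence δ e) ⟨e, fun j hj => by
          simp [collapseSequence, hj.not_gt, hj.ne'], by simpa [collapseSequence] using he⟩
        exact ⟨n, fun _ => hn⟩
      · exact ⟨0, fun h => (he h).elim⟩
    choose n hn using hstep
    refine ⟨∑ i, δ i + ∑ e, n e, fun K _ _ N S hS hδ => ?_⟩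
    rcases exists_regularSequence_or_collapse hS hδ with ⟨s, G, hs, hG⟩ | ⟨e, he, S', hS', hδ', hB⟩
    · exact ⟨s, G, hs.trans (Nat.le_add_right _ _), hG⟩
    · obtain ⟨s, G, hs, hGd, hG, hGS⟩ := hn e he K N S' hS' hδ'
      refine ⟨s, G, ?_, hGd, hG, hB _ hGS⟩
      exact (hs.trans (Finset.single_le_sum (fun _ _ => Nat.zero_le _) (Finset.mem_univ e))).trans
        (Nat.le_add_left _ _)

end Descent

/-- There is a positive-integer-valued function `B` of dimension sequences
`δ ∈ ℕ^d`, independent of `N` and `K`, such that every graded subspace `V = V_1 ⊕ ⋯ ⊕ V_d` of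
`K[x_1, …, x_N]` (`K` algebraically closed) with dimension sequence `δ` is contained in the
`K`-subalgebra generated by a regular sequence `G_1, …, G_s` of forms of positive degree at
most `d`, with `s ≤ B δ`. -/
theorem statement4 (d : ℕ) :
    ∃ B : (Fin d → ℕ) → ℕ, (∀ δ, 0 < B δ) ∧
      ∀ (K : Type u) [Field K] [IsAlgClosed K] (N : ℕ)
        (V : Fin d → Submodule K (MvPolynomial (Fin N) K)),
        (∀ i, V i ≤ homogeneousSubmodule (Fin N) K ((i : ℕ) + 1)) →
        (∀ i, FiniteDimensional K (V i)) →
        ∃ (s : ℕ) (G : Fin s → MvPolynomial (Fin N) K),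
          s ≤ B (fun i => Module.finrank K (V i)) ∧
          (∀ j, ∃ e : ℕ, 0 < e ∧ e ≤ d ∧ (G j).IsHomogeneous e) ∧
          RingTheory.Sequence.IsRegular (MvPolynomial (Fin N) K) (List.ofFn G) ∧
          ∀ F ∈ (⨆ i, V i : Submodule K (MvPolynomial (Fin N) K)),
            F ∈ Algebra.adjoin K (Set.range G) := by
  classical
  choose n hn using fun δ : Fin d → ℕ => exists_hasRegularBound.{u} δ
  refine ⟨fun δ => n δ + 1, fun δ => Nat.succ_pos _, fun K _ _ N V hV hfin => ?_⟩
  obtain ⟨s, G, hs, hGd, hG, hGS⟩ := hn (fun i => Module.finrank K (V i)) K N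
    (fun i => Finset.univ.image fun k => (Module.finBasis K (V i) k : MvPolynomial (Fin N) K))
    (fun i f hf => by
      obtain ⟨k, -, rfl⟩ := Finset.mem_image.1 hf
      exact hV i (Module.finBasis K (V i) k).2)
    (fun i => Finset.card_image_le.trans (by simp))
  refine ⟨s, G, hs.trans (Nat.le_succ _), hGd, hG, fun F hF => ?_⟩
  have hle : ⨆ i, V i ≤ Subalgebra.toSubmodule (Algebra.adjoin K (Set.range G)) := by
    refine iSup_le fun i v hv => ?_
    have := congrArg Subtype.val ((Module.finBasis K (V i)).sum_repr ⟨v, hv⟩)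
    rw [← show _ = v from this, AddSubmonoidClass.coe_finsetSum]
    refine Submodule.sum_mem _ fun k _ => Submodule.smul_mem _ _ ?_
    exact hGS i _ (Finset.mem_image_of_mem _ (Finset.mem_univ k))
  exact hle hF
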